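/- Let T ⊆ ℝ⁶ determine a cube tiling of ℝ⁶ and suppose T contains four vectors w¹, w², w³, w⁴ with the following pattern: (i) in each of coordinates 4, 5, 6 all four vectors agree; (ii) in coordinate 1: w¹₁ = w³₁, w²₁ − w¹₁ is a nonzero integer, and w⁴₁ − w¹₁ is not an integer; (iii) in coordinate 2: w⁴₂ = w¹₂, w³₂ − w¹₂ is a nonzero integer, and w²₂ − w¹₂ is not an integer; (iv) in coordinate 3: w¹₃ = w²₃, w⁴₃ − w¹₃ is a nonzero integer, and w³₃ − w¹₃ is not an integer. Then T contains a column, i.e., there exist s ∈ ℝ⁶ and a standard basis vector eᵢ such that s + k·eᵢ ∈ T for every k ∈ ℤ. -/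

import Mathlib

/-- The half-open unit cube `[0,1)ⁿ` translated by `t`. -/
def Cube {n : ℕ} (t : Fin n → ℝ) : Set (Fin n → ℝ) :=
  {x | ∀ j, t j ≤ x j ∧ x j < t j + 1}

/-- `T` determines a cube tiling of `ℝⁿ`: the cubes `[0,1)ⁿ + t`, `t ∈ T`,
are pairwise disjoint and their union is all of `ℝⁿ`. -/
def IsCubeTiling {n : ℕ} (T : Set (Fin n → ℝ)) : Prop :=
  (∀ s ∈ T, ∀ t ∈ T, s ≠ t → Disjoint (Cube s) (Cube t)) ∧
  (⋃ t ∈ T, Cube t) = Set.univ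

/-- `T ⊆ ℝ` determines a tiling of `ℝ` by unit intervals `[0,1) + t`. -/
def IsCubeTiling1 (T : Set ℝ) : Prop :=
  (∀ s ∈ T, ∀ t ∈ T, s ≠ t → Disjoint (Set.Ico s (s + 1)) (Set.Ico t (t + 1))) ∧
  (⋃ t ∈ T, Set.Ico t (t + 1)) = Set.univ

/-- The tiling determined by `T` contains a column: there are `s ∈ ℝⁿ` and a
standard basis vector `eᵢ` such that `s + k·eᵢ ∈ T` for every `k ∈ ℤ`. -/
def ContainsColumn {n : ℕ} (T : Set (Fin n → ℝ)) : Prop :=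
  ∃ s : Fin n → ℝ, ∃ i : Fin n, ∀ k : ℤ, (s + (k : ℝ) • (Pi.single i 1 : Fin n → ℝ)) ∈ T

/-- A natural code of `ℝⁿ`: each `ε j : ℝ → ℕ⁺` restricts to a bijection from
every coset `x + ℤ` onto the positive integers. -/
def IsNaturalCode {n : ℕ} (ε : Fin n → ℝ → ℕ+) : Prop :=
  ∀ j : Fin n, ∀ x : ℝ, Set.BijOn (ε j) {y : ℝ | ∃ m : ℤ, y = x + m} Set.univ

namespace FourVec

variable {C K : Type}

/-- The selection `f` picks the label of `a`. -/
def M (f : C → K) (a : C × K) : Prop := f a.1 = a.2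

/-- Same class, different label. -/
def Sp (a b : C × K) : Prop := a.1 = b.1 ∧ a.2 ≠ b.2

theorem M_eq {f : C → K} {a b : C × K} (ha : M f a) (hb : M f b) (h : a.1 = b.1) : a = b := by
  unfold M at *
  ext
  · exact h
  · rw [← ha, ← hb, h]

theorem M_notSp {f : C → K} {a b : C × K} (ha : M f a) (hb : M f b) : ¬ Sp a b := by
  rintro ⟨h1, h2⟩
  exact h2 (by rw [M_eq ha hb h1])

theorem Sp.symm {a b : C × K} (h : Sp a b) : Sp b a := ⟨h.1.symm, h.2.symm⟩

open Classical in
theorem exists_upd (f : C → K) (q : C) (k : K) :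
    ∃ g : C → K, M g (q, k) ∧ ∀ z : C × K, z.1 ≠ q → M f z → M g z := by
  refine ⟨Function.update f q k, by simp [M], ?_⟩
  intro z hz hf
  simpa [M, Function.update_of_ne hz] using hf

open Classical in
theorem exists_M2 (a b : C × K) (h : ¬ Sp a b) : ∃ f : C → K, M f a ∧ M f b := by
  refine ⟨fun q => if q = a.1 then a.2 else b.2, by simp [M], ?_⟩
  unfold M
  by_cases h1 : b.1 = a.1
  · simp only [h1, if_true]
    by_contra h2
    exact h ⟨h1.symm, h2⟩
  · simp [h1]

theorem two_dim_aux (H : C × K → C × K → Prop) (Z1 Z2 : Set (C × K))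
    (hZ1 : ∃ f : C → K, ∀ z ∈ Z1, M f z) (hZ2 : ∃ f : C → K, ∀ z ∈ Z2, M f z)
    (ex : ∀ f1 f2 : C → K, (∀ z ∈ Z1, M f1 z) → (∀ z ∈ Z2, M f2 z) →
      ∃ a b, H a b ∧ M f1 a ∧ M f2 b)
    (sep : ∀ a b a' b', H a b → H a' b' → (a = a' ∧ b = b') ∨ Sp a a' ∨ Sp b b')
    (nc2 : ∀ a q, ∃ k, ¬ H a (q, k))
    (a b : C × K) (hab : H a b) (ha : ∀ z ∈ Z1, z.1 ≠ a.1) (hb : b ∈ Z2) :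
    ∃ q, (∀ z ∈ Z1, z.1 ≠ q) ∧ ∀ k, ∃ z ∈ Z2, H (q, k) z := by
  refine ⟨a.1, ha, ?_⟩
  intro k
  obtain ⟨f1, hf1⟩ := hZ1
  obtain ⟨f2, hf2⟩ := hZ2
  by_cases hk : k = a.2
  · subst hk
    exact ⟨b, hb, hab⟩
  obtain ⟨g1, hg1, hg1'⟩ := exists_upd f1 a.1 k
  have hgZ : ∀ z ∈ Z1, M g1 z := fun z hz => hg1' z (ha z hz) (hf1 z hz)
  have key : ∀ f2 : C → K, (∀ z ∈ Z2, M f2 z) → ∃ b', H (a.1, k) b' ∧ M f2 b' := by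
    intro f2 hf2
    obtain ⟨a', b', h1, h2, h3⟩ := ex g1 f2 hgZ hf2
    rcases sep a b a' b' hab h1 with h | h | h
    · exfalso
      rw [← h.1] at h2
      have := M_eq hg1 h2 rfl
      exact hk (by rw [← this])
    · have := M_eq hg1 h2 h.1
      rw [this]
      exact ⟨b', h1, h3⟩
    · exact absurd h (M_notSp (hf2 b hb) h3)
  obtain ⟨b', h1, h2⟩ := key f2 hf2
  by_cases hb' : b' ∈ Z2
  · exact ⟨b', hb', h1⟩
  exfalso
  have hb'' : ∀ z ∈ Z2, z.1 ≠ b'.1 := by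
    intro z hz he
    exact hb' (M_eq (hf2 z hz) h2 he ▸ hz)
  obtain ⟨k', hk'⟩ := nc2 (a.1, k) b'.1
  obtain ⟨g2, hg2, hg2'⟩ := exists_upd f2 b'.1 k'
  obtain ⟨b2, h4, h5⟩ := key g2 (fun z hz => hg2' z (hb'' z hz) (hf2 z hz))
  rcases sep _ _ _ _ h1 h4 with h | h | h
  · rw [← h.2] at h5
    have := M_eq hg2 h5 rfl
    rw [this] at hk'
    exact hk' h1
  · exact h.2 rfl
  · have := M_eq hg2 h5 h.1
    rw [this] at hk'
    exact hk' h4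

theorem two_dim (H : C × K → C × K → Prop) (Z1 Z2 : Set (C × K))
    (hZ1 : ∃ f : C → K, ∀ z ∈ Z1, M f z) (hZ2 : ∃ f : C → K, ∀ z ∈ Z2, M f z)
    (ex : ∀ f1 f2 : C → K, (∀ z ∈ Z1, M f1 z) → (∀ z ∈ Z2, M f2 z) →
      ∃ a b, H a b ∧ M f1 a ∧ M f2 b)
    (sep : ∀ a b a' b', H a b → H a' b' → (a = a' ∧ b = b') ∨ Sp a a' ∨ Sp b b')
    (nc1 : ∀ q b, ∃ k, ¬ H (q, k) b)
    (nc2 : ∀ a q, ∃ k, ¬ H a (q, k)) :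
    (∃ z1 ∈ Z1, ∃ z2 ∈ Z2, H z1 z2) ∨
    (∃ q, (∀ z ∈ Z1, z.1 ≠ q) ∧ ∀ k, ∃ z ∈ Z2, H (q, k) z) ∨
    (∃ q, (∀ z ∈ Z2, z.1 ≠ q) ∧ ∀ k, ∃ z ∈ Z1, H z (q, k)) := by
  have A1 := two_dim_aux H Z1 Z2 hZ1 hZ2 ex sep nc2
  have A2 := two_dim_aux (fun a b => H b a) Z2 Z1 hZ2 hZ1
    (fun f1 f2 h1 h2 => by
      obtain ⟨a, b, h, h', h''⟩ := ex f2 f1 h2 h1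
      exact ⟨b, a, h, h'', h'⟩)
    (fun a b a' b' h h' => by
      rcases sep _ _ _ _ h h' with h | h | h
      · exact Or.inl ⟨h.2, h.1⟩
      · exact Or.inr (Or.inr h)
      · exact Or.inr (Or.inl h))
    (fun a q => nc1 q a)
  obtain ⟨f1, hf1⟩ := hZ1
  obtain ⟨f2, hf2⟩ := hZ2
  have out1 : ∀ f : C → K, (∀ z ∈ Z1, M f z) → ∀ a, M f a → a ∉ Z1 → ∀ z ∈ Z1, z.1 ≠ a.1 := by
    intro f hf a ha hn z hz he
    exact hn (M_eq (hf z hz) ha he ▸ hz)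
  have out2 : ∀ f : C → K, (∀ z ∈ Z2, M f z) → ∀ a, M f a → a ∉ Z2 → ∀ z ∈ Z2, z.1 ≠ a.1 := by
    intro f hf a ha hn z hz he
    exact hn (M_eq (hf z hz) ha he ▸ hz)
  obtain ⟨a, b, hab, ha, hb⟩ := ex f1 f2 hf1 hf2
  by_cases haZ : a ∈ Z1
  · by_cases hbZ : b ∈ Z2
    · exact Or.inl ⟨a, haZ, b, hbZ, hab⟩
    · exact Or.inr (Or.inr (A2 b a hab (out2 f2 hf2 b hb hbZ) haZ))
  by_cases hbZ : b ∈ Z2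
  · exact Or.inr (Or.inl (A1 a b hab (out1 f1 hf1 a ha haZ) hbZ))
  obtain ⟨k, hk⟩ := nc1 a.1 b
  have hka : k ≠ a.2 := by
    rintro rfl
    exact hk hab
  obtain ⟨g1, hg1, hg1'⟩ := exists_upd f1 a.1 k
  have hgZ : ∀ z ∈ Z1, M g1 z :=
    fun z hz => hg1' z (out1 f1 hf1 a ha haZ z hz) (hf1 z hz)
  have key : ∀ f2 : C → K, (∀ z ∈ Z2, M f2 z) → M f2 b → ∃ b', H (a.1, k) b' ∧ M f2 b' := by
    intro f2 hf2 hb2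
    obtain ⟨a', b', h1, h2, h3⟩ := ex g1 f2 hgZ hf2
    rcases sep a b a' b' hab h1 with h | h | h
    · exfalso
      rw [← h.1] at h2
      have := M_eq hg1 h2 rfl
      exact hka (by rw [← this])
    · have := M_eq hg1 h2 h.1
      rw [this]
      exact ⟨b', h1, h3⟩
    · exact absurd h (M_notSp hb2 h3)
  obtain ⟨b', h1, h2⟩ := key f2 hf2 hb
  have hbb : b.1 ≠ b'.1 := by
    intro he
    have := M_eq hb h2 he
    rw [this] at hk
    exact hk h1
  by_cases hb'Z : b' ∈ Z2
  · exact Or.inr (Or.inl (A1 (a.1, k) b' h1 (out1 f1 hf1 a ha haZ) hb'Z))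
  exfalso
  obtain ⟨k', hk'⟩ := nc2 (a.1, k) b'.1
  obtain ⟨g2, hg2, hg2'⟩ := exists_upd f2 b'.1 k'
  obtain ⟨b2, h4, h5⟩ := key g2 (fun z hz => hg2' z (out2 f2 hf2 b' h2 hb'Z z hz) (hf2 z hz))
    (hg2' b hbb hb)
  rcases sep _ _ _ _ h1 h4 with h | h | h
  · rw [← h.2] at h5
    have := M_eq hg2 h5 rfl
    rw [this] at hk'
    exact hk' h1
  · exact h.2 rfl
  · have := M_eq hg2 h5 h.1
    rw [this] at hk'
    exact hk' h4

def Cov3 (F : C × K → C × K → C × K → Prop) (w1 w2 w3 : C × K) : Prop :=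
  ∀ f1 f2 f3 : C → K, M f1 w1 → M f2 w2 → M f3 w3 →
    ∃ a b c, F a b c ∧ M f1 a ∧ M f2 b ∧ M f3 c

def Sep3 (F : C × K → C × K → C × K → Prop) : Prop :=
  ∀ a b c a' b' c', F a b c → F a' b' c' →
    (a = a' ∧ b = b' ∧ c = c') ∨ Sp a a' ∨ Sp b b' ∨ Sp c c'

def NC3 (F : C × K → C × K → C × K → Prop) : Prop :=
  (∀ q b c, ∃ k, ¬ F (q, k) b c) ∧ (∀ a q c, ∃ k, ¬ F a (q, k) c) ∧
    (∀ a b q, ∃ k, ¬ F a b (q, k))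

def Pat (F : C × K → C × K → C × K → Prop) (w1 w2 w3 : C × K) : Prop :=
  ∃ x0 x1 y0 y1 z0 z1, Sp x0 x1 ∧ Sp y0 y1 ∧ Sp z0 z1 ∧
    x0.1 ≠ w1.1 ∧ y0.1 ≠ w2.1 ∧ z0.1 ≠ w3.1 ∧
    F x0 y0 z0 ∧ F x1 w2 z0 ∧ F x0 y1 w3 ∧ F w1 y0 z1

theorem Cov3.rot {F : C × K → C × K → C × K → Prop} {w1 w2 w3 : C × K} (h : Cov3 F w1 w2 w3) :
    Cov3 (fun a b c => F c a b) w2 w3 w1 := by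
  intro f1 f2 f3 h1 h2 h3
  obtain ⟨a, b, c, h, ha, hb, hc⟩ := h f3 f1 f2 h3 h1 h2
  exact ⟨b, c, a, h, hb, hc, ha⟩

theorem Sep3.rot {F : C × K → C × K → C × K → Prop} (h : Sep3 F) :
    Sep3 (fun a b c => F c a b) := by
  intro a b c a' b' c' h1 h2
  have := h _ _ _ _ _ _ h1 h2
  tauto

theorem NC3.rot {F : C × K → C × K → C × K → Prop} (h : NC3 F) :
    NC3 (fun a b c => F c a b) :=
  ⟨fun q b c => h.2.1 c q b, fun a q c => h.2.2 c a q, fun a b q => h.1 q a b⟩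

theorem Pat.rot {F : C × K → C × K → C × K → Prop} {w1 w2 w3 : C × K}
    (h : Pat (fun a b c => F c a b) w2 w3 w1) : Pat F w1 w2 w3 := by
  obtain ⟨x0, x1, y0, y1, z0, z1, h1, h2, h3, h4, h5, h6, h7, h8, h9, h10⟩ := h
  exact ⟨z0, z1, x0, x1, y0, y1, h3, h1, h2, h6, h4, h5, h7, h10, h8, h9⟩

/-- section lemma: first coordinate moved away from a member `(a,b,c)` -/
theorem section1 {F : C × K → C × K → C × K → Prop} {w1 w2 w3 : C × K}
    (hc : Cov3 F w1 w2 w3) (hs : Sep3 F) (hn : NC3 F) {a b c : C × K} (h : F a b c)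
    (ha : a.1 ≠ w1.1) (hb : b = w2 ∨ b.1 ≠ w2.1) (hc' : c = w3 ∨ c.1 ≠ w3.1)
    (k : K) (hk : k ≠ a.2) :
    (∃ z1 ∈ ({w2, b} : Set (C × K)), ∃ z2 ∈ ({w3, c} : Set (C × K)), F (a.1, k) z1 z2) ∨
    (∃ q, (∀ z ∈ ({w2, b} : Set (C × K)), z.1 ≠ q) ∧
      ∀ j, ∃ z ∈ ({w3, c} : Set (C × K)), F (a.1, k) (q, j) z) ∨
    (∃ q, (∀ z ∈ ({w3, c} : Set (C × K)), z.1 ≠ q) ∧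
      ∀ j, ∃ z ∈ ({w2, b} : Set (C × K)), F (a.1, k) z (q, j)) := by
  apply two_dim (fun y z => F (a.1, k) y z)
  · obtain ⟨f, h1, h2⟩ := exists_M2 w2 b (by
      rintro ⟨h1, h2⟩
      rcases hb with rfl | hb
      · exact h2 rfl
      · exact hb h1.symm)
    exact ⟨f, by rintro z (rfl | rfl) <;> assumption⟩
  · obtain ⟨f, h1, h2⟩ := exists_M2 w3 c (by
      rintro ⟨h1, h2⟩
      rcases hc' with rfl | hb
      · exact h2 rfl
      · exact hb h1.symm)
    exact ⟨f, by rintro z (rfl | rfl) <;> assumption⟩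
  · intro f2 f3 h2 h3
    obtain ⟨g1, hg1, hg1'⟩ := exists_upd (fun _ => w1.2) a.1 k
    obtain ⟨a', b', c', h', hA, hB, hC⟩ := hc g1 f2 f3 (hg1' w1 ha.symm rfl) (h2 w2 (by simp))
      (h3 w3 (by simp))
    rcases hs _ _ _ _ _ _ h h' with h4 | h4 | h4 | h4
    · exfalso
      rw [← h4.1] at hA
      have := M_eq hg1 hA rfl
      exact hk (by rw [← this])
    · have := M_eq hg1 hA h4.1
      rw [this]
      exact ⟨b', c', h', hB, hC⟩
    · exact absurd h4 (M_notSp (h2 b (by simp)) hB)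
    · exact absurd h4 (M_notSp (h3 c (by simp)) hC)
  · intro y z y' z' h1 h2
    rcases hs _ _ _ _ _ _ h1 h2 with h4 | h4 | h4 | h4
    · exact Or.inl h4.2
    · exact absurd rfl h4.2
    · exact Or.inr (Or.inl h4)
    · exact Or.inr (Or.inr h4)
  · intro q z
    exact hn.2.1 _ q z
  · intro y q
    exact hn.2.2 _ y q

/-- no member with exactly two stars -/
theorem no_two_star1 {F : C × K → C × K → C × K → Prop} {w1 w2 w3 : C × K}
    (hc : Cov3 F w1 w2 w3) (hs : Sep3 F) (hn : NC3 F) {a : C × K} (ha : a.1 ≠ w1.1) :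
    ¬ F a w2 w3 := by
  intro h
  obtain ⟨k, hk⟩ := hn.1 a.1 w2 w3
  have hka : k ≠ a.2 := by
    rintro rfl
    exact hk h
  rcases section1 hc hs hn h ha (Or.inl rfl) (Or.inl rfl) k hka with h1 | h1 | h1
  · obtain ⟨z1, h1, z2, h2, h3⟩ := h1
    simp only [Set.mem_insert_iff, Set.mem_singleton_iff, or_self] at h1 h2
    rw [h1, h2] at h3
    exact hk h3
  · obtain ⟨q, -, h2⟩ := h1
    obtain ⟨j, hj⟩ := hn.2.1 (a.1, k) q w3
    obtain ⟨z, hz, h3⟩ := h2 j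
    simp only [Set.mem_insert_iff, Set.mem_singleton_iff, or_self] at hz
    rw [hz] at h3
    exact hj h3
  · obtain ⟨q, -, h2⟩ := h1
    obtain ⟨j, hj⟩ := hn.2.2 (a.1, k) w2 q
    obtain ⟨z, hz, h3⟩ := h2 j
    simp only [Set.mem_insert_iff, Set.mem_singleton_iff, or_self] at hz
    rw [hz] at h3
    exact hj h3

/-- from a line `(w1, b, c)`, move `b` -/
theorem line_move {F : C × K → C × K → C × K → Prop} {w1 w2 w3 : C × K}
    (hc : Cov3 F w1 w2 w3) (hs : Sep3 F) (hn : NC3 F) {a c : C × K}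
    (ha : a.1 ≠ w1.1) (hc' : c.1 ≠ w3.1) (h : F a w2 c) :
    ∃ k, k ≠ a.2 ∧ ∃ q, q ≠ w2.1 ∧ (∀ j, F (a.1, k) (q, j) w3 ∨ F (a.1, k) (q, j) c) ∧
      ∃ j, F (a.1, k) (q, j) w3 := by
  obtain ⟨k, hk⟩ := hn.1 a.1 w2 c
  have hka : k ≠ a.2 := by
    rintro rfl
    exact hk h
  refine ⟨k, hka, ?_⟩
  rcases section1 hc hs hn h ha (Or.inl rfl) (Or.inr hc') k hka with h1 | h1 | h1
  · obtain ⟨z1, h1, z2, h2, h3⟩ := h1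
    simp only [Set.mem_insert_iff, Set.mem_singleton_iff, or_self] at h1 h2
    rw [h1] at h3
    rcases h2 with rfl | rfl
    · exact absurd h3 (no_two_star1 hc hs hn ha)
    · exact absurd h3 hk
  · obtain ⟨q, hq, h2⟩ := h1
    refine ⟨q, (hq w2 (by simp)).symm, ?_, ?_⟩
    · intro j
      obtain ⟨z, hz, h3⟩ := h2 j
      rcases hz with rfl | rfl
      · exact Or.inl h3
      · exact Or.inr h3
    · obtain ⟨j, hj⟩ := hn.2.1 (a.1, k) q c
      obtain ⟨z, hz, h3⟩ := h2 j
      rcases hz with rfl | rfl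
      · exact ⟨j, h3⟩
      · exact absurd h3 hj
  · obtain ⟨q, -, h2⟩ := h1
    obtain ⟨j, hj⟩ := hn.2.2 (a.1, k) w2 q
    obtain ⟨z, hz, h3⟩ := h2 j
    simp only [Set.mem_insert_iff, Set.mem_singleton_iff, or_self] at hz
    rw [hz] at h3
    exact absurd h3 hj

/-- same, with the roles of the last two coordinates exchanged -/
theorem line_move' {F : C × K → C × K → C × K → Prop} {w1 w2 w3 : C × K}
    (hc : Cov3 F w1 w2 w3) (hs : Sep3 F) (hn : NC3 F) {a b : C × K}
    (ha : a.1 ≠ w1.1) (hb : b.1 ≠ w2.1) (h : F a b w3) :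
    ∃ k, k ≠ a.2 ∧ ∃ q, q ≠ w3.1 ∧ (∀ j, F (a.1, k) w2 (q, j) ∨ F (a.1, k) b (q, j)) ∧
      ∃ j, F (a.1, k) w2 (q, j) := by
  refine line_move (F := fun a b c => F a c b) (w1 := w1) (w2 := w3) (w3 := w2) ?_ ?_ ?_ ha hb h
  · intro f1 f2 f3 h1 h2 h3
    obtain ⟨a, b, c, h, ha, hb, hc⟩ := hc f1 f3 f2 h1 h3 h2
    exact ⟨a, c, b, h, ha, hc, hb⟩
  · intro a b c a' b' c' h1 h2
    have := hs _ _ _ _ _ _ h1 h2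
    tauto
  · exact ⟨fun q b c => hn.1 q c b, fun a q c => hn.2.2 a c q, fun a b q => hn.2.1 a q b⟩

/-- a one-star member gives the pattern -/
theorem pat_of_line {F : C × K → C × K → C × K → Prop} {w1 w2 w3 : C × K}
    (hc : Cov3 F w1 w2 w3) (hs : Sep3 F) (hn : NC3 F) {b c : C × K}
    (hb : b.1 ≠ w2.1) (hc' : c.1 ≠ w3.1) (h : F w1 b c) : Pat F w1 w2 w3 := by
  obtain ⟨k, hk, q, hq, h1, j, hj⟩ := line_move' hc.rot hs.rot hn.rot (a := b) (b := c) hb hc' h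
  obtain ⟨k2, hk2, q2, hq2, h2, j2, hj2⟩ :=
    line_move hc.rot.rot hs.rot.rot hn.rot.rot (a := c) (c := b) hc' hb h
  have hsp : Sp (q, j) (q2, j2) := by
    rcases hs _ _ _ _ _ _ hj hj2 with h4 | h4 | h4 | h4
    · exact absurd (congrArg Prod.fst h4.2.1) hb
    · exact h4
    · exact absurd h4.1 hb
    · exact absurd h4.1.symm hc'
  obtain ⟨e1, e2⟩ := hsp
  dsimp only at e1 e2
  subst e1
  refine ⟨(q, j), (q, j2), b, (b.1, k), (c.1, k2), c, ⟨rfl, e2⟩, ⟨rfl, hk.symm⟩, ⟨rfl, hk2⟩, hq,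
    hb, hc', ?_, hj2, hj, h⟩
  rcases h2 j with h5 | h5
  · exfalso
    rcases hs _ _ _ _ _ _ hj h5 with h4 | h4 | h4 | h4
    · exact absurd (congrArg Prod.fst h4.2.1) hb
    · exact h4.2 rfl
    · exact hb h4.1
    · exact hc' h4.1.symm
  · exact h5

theorem pat_of_nontrivial {F : C × K → C × K → C × K → Prop} {w1 w2 w3 : C × K}
    (hc : Cov3 F w1 w2 w3) (hs : Sep3 F) (hn : NC3 F) (hw : ¬ F w1 w2 w3) : Pat F w1 w2 w3 := by
  have P1 : ∀ b c, b.1 ≠ w2.1 → c.1 ≠ w3.1 → F w1 b c → Pat F w1 w2 w3 :=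
    fun b c hb hc' h => pat_of_line hc hs hn hb hc' h
  have P2 : ∀ a c, a.1 ≠ w1.1 → c.1 ≠ w3.1 → F a w2 c → Pat F w1 w2 w3 :=
    fun a c ha hc' h => (pat_of_line hc.rot hs.rot hn.rot (b := c) (c := a) hc' ha h).rot
  have P3 : ∀ a b, a.1 ≠ w1.1 → b.1 ≠ w2.1 → F a b w3 → Pat F w1 w2 w3 :=
    fun a b ha hb h =>
      (pat_of_line hc.rot.rot hs.rot.rot hn.rot.rot (b := a) (c := b) ha hb h).rot.rot
  have N1 : ∀ a, a.1 ≠ w1.1 → ¬ F a w2 w3 := fun a ha => no_two_star1 hc hs hn ha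
  have N2 : ∀ b, b.1 ≠ w2.1 → ¬ F w1 b w3 := fun a ha => no_two_star1 hc.rot hs.rot hn.rot ha
  have N3 : ∀ c, c.1 ≠ w3.1 → ¬ F w1 w2 c :=
    fun a ha => no_two_star1 hc.rot.rot hs.rot.rot hn.rot.rot ha
  obtain ⟨a, b, c, h, ha, hb, hc'⟩ := hc (fun _ => w1.2) (fun _ => w2.2) (fun _ => w3.2) rfl rfl rfl
  have ha' : a = w1 ∨ a.1 ≠ w1.1 := by
    by_cases e : a.1 = w1.1
    · exact Or.inl (Prod.ext e ha.symm)
    · exact Or.inr e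
  have hb' : b = w2 ∨ b.1 ≠ w2.1 := by
    by_cases e : b.1 = w2.1
    · exact Or.inl (Prod.ext e hb.symm)
    · exact Or.inr e
  have hc'' : c = w3 ∨ c.1 ≠ w3.1 := by
    by_cases e : c.1 = w3.1
    · exact Or.inl (Prod.ext e hc'.symm)
    · exact Or.inr e
  rcases ha' with rfl | ha'
  · rcases hb' with rfl | hb'
    · rcases hc'' with rfl | hc''
      · exact absurd h hw
      · exact absurd h (N3 c hc'')
    · rcases hc'' with rfl | hc''
      · exact absurd h (N2 b hb')
      · exact P1 b c hb' hc'' h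
  · rcases hb' with rfl | hb'
    · rcases hc'' with rfl | hc''
      · exact absurd h (N1 a ha')
      · exact P2 a c ha' hc'' h
    · rcases hc'' with rfl | hc''
      · exact P3 a b ha' hb' h
      · obtain ⟨k, hk⟩ := hn.1 a.1 b c
        have hka : k ≠ a.2 := by
          rintro rfl
          exact hk h
        rcases section1 hc hs hn h ha' (Or.inr hb') (Or.inr hc'') k hka with h1 | h1 | h1
        · obtain ⟨z1, h1, z2, h2, h3⟩ := h1
          rcases h1 with rfl | rfl
          · rcases h2 with rfl | rfl
            · exact absurd h3 (N1 _ ha')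
            · exact P2 (a.1, k) _ ha' hc'' h3
          · rcases h2 with rfl | rfl
            · exact P3 (a.1, k) _ ha' hb' h3
            · exact absurd h3 hk
        · obtain ⟨q, hq, h2⟩ := h1
          obtain ⟨j, hj⟩ := hn.2.1 (a.1, k) q c
          obtain ⟨z, hz, h3⟩ := h2 j
          rcases hz with rfl | rfl
          · exact P3 (a.1, k) (q, j) ha' (hq w2 (by simp)).symm h3
          · exact absurd h3 hj
        · obtain ⟨q, hq, h2⟩ := h1
          obtain ⟨j, hj⟩ := hn.2.2 (a.1, k) b q
          obtain ⟨z, hz, h3⟩ := h2 j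
          rcases hz with rfl | rfl
          · exact P2 (a.1, k) (q, j) ha' (hq w3 (by simp)).symm h3
          · exact absurd h3 hj

abbrev Fam (C K : Type) : Type :=
  C × K → C × K → C × K → C × K → C × K → C × K → Prop

def Ex6 (T : Fam C K) : Prop :=
  ∀ f1 f2 f3 f4 f5 f6 : C → K, ∃ a b c d e g, T a b c d e g ∧
    M f1 a ∧ M f2 b ∧ M f3 c ∧ M f4 d ∧ M f5 e ∧ M f6 g

def Sep6 (T : Fam C K) : Prop :=
  ∀ a b c d e g a' b' c' d' e' g', T a b c d e g → T a' b' c' d' e' g' →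
    (a = a' ∧ b = b' ∧ c = c' ∧ d = d' ∧ e = e' ∧ g = g') ∨
    Sp a a' ∨ Sp b b' ∨ Sp c c' ∨ Sp d d' ∨ Sp e e' ∨ Sp g g'

def NC6 (T : Fam C K) : Prop :=
  (∀ q b c d e g, ∃ k, ¬ T (q, k) b c d e g) ∧
  (∀ a q c d e g, ∃ k, ¬ T a (q, k) c d e g) ∧
  (∀ a b q d e g, ∃ k, ¬ T a b (q, k) d e g) ∧
  (∀ a b c q e g, ∃ k, ¬ T a b c (q, k) e g) ∧
  (∀ a b c d q g, ∃ k, ¬ T a b c d (q, k) g) ∧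
  (∀ a b c d e q, ∃ k, ¬ T a b c d e (q, k))

/-- exchange the two halves -/
def swapT (T : Fam C K) : Fam C K := fun a b c d e g => T d e g a b c

/-- rotate the second half -/
def rotT (T : Fam C K) : Fam C K := fun a b c d e g => T a b c g d e

theorem Ex6.swap {T : Fam C K} (h : Ex6 T) : Ex6 (swapT T) := by
  intro f1 f2 f3 f4 f5 f6
  obtain ⟨a, b, c, d, e, g, h, h1, h2, h3, h4, h5, h6⟩ := h f4 f5 f6 f1 f2 f3
  exact ⟨d, e, g, a, b, c, h, h4, h5, h6, h1, h2, h3⟩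

theorem Ex6.rot {T : Fam C K} (h : Ex6 T) : Ex6 (rotT T) := by
  intro f1 f2 f3 f4 f5 f6
  obtain ⟨a, b, c, d, e, g, h, h1, h2, h3, h4, h5, h6⟩ := h f1 f2 f3 f6 f4 f5
  exact ⟨a, b, c, e, g, d, h, h1, h2, h3, h5, h6, h4⟩

theorem Sep6.swap {T : Fam C K} (h : Sep6 T) : Sep6 (swapT T) := by
  intro a b c d e g a' b' c' d' e' g' h1 h2
  have := h _ _ _ _ _ _ _ _ _ _ _ _ h1 h2
  tauto

theorem Sep6.rot {T : Fam C K} (h : Sep6 T) : Sep6 (rotT T) := by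
  intro a b c d e g a' b' c' d' e' g' h1 h2
  have := h _ _ _ _ _ _ _ _ _ _ _ _ h1 h2
  tauto

theorem NC6.swap {T : Fam C K} (h : NC6 T) : NC6 (swapT T) := by
  obtain ⟨h1, h2, h3, h4, h5, h6⟩ := h
  exact ⟨fun q b c d e g => h4 d e g q b c, fun a q c d e g => h5 d e g a q c,
    fun a b q d e g => h6 d e g a b q, fun a b c q e g => h1 q e g a b c,
    fun a b c d q g => h2 d q g a b c, fun a b c d e q => h3 d e q a b c⟩

theorem NC6.rot {T : Fam C K} (h : NC6 T) : NC6 (rotT T) := by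
  obtain ⟨h1, h2, h3, h4, h5, h6⟩ := h
  exact ⟨fun q b c d e g => h1 q b c g d e, fun a q c d e g => h2 a q c g d e,
    fun a b q d e g => h3 a b q g d e, fun a b c q e g => h5 a b c g q e,
    fun a b c d q g => h6 a b c g d q, fun a b c d e q => h4 a b c q d e⟩

theorem line6 {T : Fam C K} (hE : Ex6 T) (hS : Sep6 T) (hN : NC6 T)
    {a0 a1 b0 β c0 c1 α w4 w5 w6 : C × K}
    (h1 : T a0 b0 c0 w4 w5 w6) (h2 : T a1 β c0 w4 w5 w6) (h3 : T α b0 c1 w4 w5 w6)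
    (ha : Sp a0 a1) (hc : Sp c0 c1) (hα : α.1 ≠ a0.1) (hβ : β.1 ≠ b0.1) :
    ∃ k, k ≠ β.2 ∧ Pat (T a1 (β.1, k) c0) w4 w5 w6 := by
  obtain ⟨k, hk⟩ := hN.2.1 a1 β.1 c0 w4 w5 w6
  have hkb : k ≠ β.2 := by
    rintro rfl
    exact hk h2
  refine ⟨k, hkb, pat_of_nontrivial ?_ ?_ ?_ hk⟩
  · intro f4 f5 f6 m4 m5 m6
    obtain ⟨a, b, c, d, e, g, h, M1, M2, M3, M4, M5, M6⟩ :=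
      hE (fun _ => a1.2) (fun _ => k) (fun _ => c0.2) f4 f5 f6
    have n4 := M_notSp M4 m4
    have n5 := M_notSp M5 m5
    have n6 := M_notSp M6 m6
    have e2 : b = (β.1, k) := by
      rcases hS _ _ _ _ _ _ _ _ _ _ _ _ h h2 with h' | h' | h' | h' | h' | h' | h'
      · exfalso
        rw [h'.2.1] at M2
        exact hkb M2
      · exact absurd M1.symm h'.2
      · exact Prod.ext h'.1 M2.symm
      · exact absurd M3.symm h'.2
      · exact absurd h' n4
      · exact absurd h' n5
      · exact absurd h' n6
    have e1 : a = a1 := by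
      rcases hS _ _ _ _ _ _ _ _ _ _ _ _ h h1 with h' | h' | h' | h' | h' | h' | h'
      · rw [e2] at h'
        exact absurd (congrArg Prod.fst h'.2.1) hβ
      · exact Prod.ext (h'.1.trans ha.1) M1.symm
      · rw [e2] at h'
        exact absurd h'.1 hβ
      · exact absurd M3.symm h'.2
      · exact absurd h' n4
      · exact absurd h' n5
      · exact absurd h' n6
    have e3 : c = c0 := by
      rcases hS _ _ _ _ _ _ _ _ _ _ _ _ h h3 with h' | h' | h' | h' | h' | h' | h'
      · rw [e2] at h'
        exact absurd (congrArg Prod.fst h'.2.1) hβ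
      · rw [e1] at h'
        exact absurd (ha.1.trans h'.1).symm hα
      · rw [e2] at h'
        exact absurd h'.1 hβ
      · exact Prod.ext (h'.1.trans hc.1.symm) M3.symm
      · exact absurd h' n4
      · exact absurd h' n5
      · exact absurd h' n6
    subst e1 e2 e3
    exact ⟨d, e, g, h, M4, M5, M6⟩
  · intro a b c a' b' c' h h'
    rcases hS _ _ _ _ _ _ _ _ _ _ _ _ h h' with h | h | h | h | h
    · exact Or.inl h.2.2.2
    · exact absurd rfl h.2
    · exact absurd rfl h.2
    · exact absurd rfl h.2
    · exact Or.inr h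
  · exact ⟨fun q b c => hN.2.2.2.1 _ _ _ q b c, fun q b c => hN.2.2.2.2.1 _ _ _ q b c,
      fun q b c => hN.2.2.2.2.2 _ _ _ q b c⟩

def Kill (T : Fam C K) (u1 u2 u3 v4 v5 v6 : C × K) : Prop :=
  ∀ t1 t2 t3 s4 s5 s6, T t1 t2 t3 s4 s5 s6 → t1.1 = u1.1 → t2.1 = u2.1 → t3.1 = u3.1 →
    ¬ Sp s4 v4 → ¬ Sp s5 v5 → ¬ Sp s6 v6 → t1 ≠ u1 ∧ t2 ≠ u2 ∧ t3 ≠ u3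

theorem kill_of_pat {T : Fam C K} (hS : Sep6 T) {u1 u2 u3 v4 v5 v6 : C × K}
    (h : Pat (swapT T v4 v5 v6) u1 u2 u3) : Kill T u1 u2 u3 v4 v5 v6 := by
  obtain ⟨x0, x1, y0, y1, z0, z1, hx, hy, hz, nx, ny, nz, -, H2, H3, H1⟩ := h
  intro t1 t2 t3 s4 s5 s6 ht e1 e2 e3 n4 n5 n6
  have nx1 : t1.1 ≠ x1.1 := by rw [← hx.1, e1]; exact nx.symm
  have nx0 : t1.1 ≠ x0.1 := by rw [e1]; exact nx.symm
  have ny1 : t2.1 ≠ y1.1 := by rw [← hy.1, e2]; exact ny.symm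
  have ny0 : t2.1 ≠ y0.1 := by rw [e2]; exact ny.symm
  have nz1 : t3.1 ≠ z1.1 := by rw [← hz.1, e3]; exact nz.symm
  have nz0 : t3.1 ≠ z0.1 := by rw [e3]; exact nz.symm
  refine ⟨?_, ?_, ?_⟩
  · rintro rfl
    rcases hS _ _ _ _ _ _ _ _ _ _ _ _ ht H1 with h' | h' | h' | h' | h' | h' | h'
    · exact ny0 (congrArg Prod.fst h'.2.1)
    · exact h'.2 rfl
    · exact ny0 h'.1
    · exact nz1 h'.1
    · exact n4 h'
    · exact n5 h'
    · exact n6 h'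
  · rintro rfl
    rcases hS _ _ _ _ _ _ _ _ _ _ _ _ ht H2 with h' | h' | h' | h' | h' | h' | h'
    · exact nx1 (congrArg Prod.fst h'.1)
    · exact nx1 h'.1
    · exact h'.2 rfl
    · exact nz0 h'.1
    · exact n4 h'
    · exact n5 h'
    · exact n6 h'
  · rintro rfl
    rcases hS _ _ _ _ _ _ _ _ _ _ _ _ ht H3 with h' | h' | h' | h' | h' | h' | h'
    · exact nx0 (congrArg Prod.fst h'.1)
    · exact nx0 h'.1
    · exact ny1 h'.1
    · exact h'.2 rfl
    · exact n4 h'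
    · exact n5 h'
    · exact n6 h'

theorem kill_line {T : Fam C K} (hE : Ex6 T) (hS : Sep6 T) (hN : NC6 T)
    {u1 u2 u3 x0 x1 y0 z0 z1 w4 w5 : C × K}
    (h1 : T u1 u2 u3 x0 y0 z0) (h2 : T u1 u2 u3 x1 w5 z0) (h3 : T u1 u2 u3 w4 y0 z1)
    (hx : Sp x0 x1) (hz : Sp z0 z1) (n4 : w4.1 ≠ x0.1) (n5 : w5.1 ≠ y0.1) :
    ∃ w5', Sp w5 w5' ∧ Kill T u1 u2 u3 x1 w5' z0 := by
  obtain ⟨k, hk, hp⟩ := line6 hE.swap hS.swap hN.swap (a0 := x0) (a1 := x1) (b0 := y0) (β := w5)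
    (c0 := z0) (c1 := z1) (α := w4) h1 h2 h3 hx hz n4 n5
  exact ⟨(w5.1, k), ⟨rfl, hk.symm⟩, kill_of_pat hS hp⟩

def app (T : Fam C K) (t : Fin 6 → C × K) : Prop := T (t 0) (t 1) (t 2) (t 3) (t 4) (t 5)

def sgn (S : Fin 6 → Bool) : ℤ := ∏ i, (if S i then -1 else 1)

def pt (a b : Fin 6 → C × K) (S : Fin 6 → Bool) : Fin 6 → C × K :=
  fun i => if S i then b i else a i

open Classical in
theorem parity {T : Fam C K} (hE : Ex6 T) (hS : Sep6 T) (a b : Fin 6 → C × K)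
    (hab : ∀ i, Sp (a i) (b i)) :
    ∑ S : Fin 6 → Bool, (if app T (pt a b S) then sgn S else 0) = 0 := by
  have hpt : ∀ S i, (pt a b S i).1 = (a i).1 := by
    intro S i
    unfold pt
    split_ifs
    · exact (hab i).1.symm
    · rfl
  let ff : (Fin 6 → Bool) → Fin 6 → C → K :=
    fun S i q => if q = (a i).1 then (pt a b S i).2 else (a i).2
  have hex : ∀ S : Fin 6 → Bool, ∃ t, app T t ∧ ∀ i, M (ff S i) (t i) := by
    intro S
    obtain ⟨t0, t1, t2, t3, t4, t5, h, m0, m1, m2, m3, m4, m5⟩ :=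
      hE (ff S 0) (ff S 1) (ff S 2) (ff S 3) (ff S 4) (ff S 5)
    refine ⟨![t0, t1, t2, t3, t4, t5], h, ?_⟩
    intro i
    fin_cases i
    · exact m0
    · exact m1
    · exact m2
    · exact m3
    · exact m4
    · exact m5
  have hun : ∀ t t', app T t → app T t' → (∀ i, ¬ Sp (t i) (t' i)) → t = t' := by
    intro t t' h h' hn
    rcases hS _ _ _ _ _ _ _ _ _ _ _ _ h h' with e | e | e | e | e | e | e
    · funext i
      fin_cases i
      · exact e.1
      · exact e.2.1
      · exact e.2.2.1
      · exact e.2.2.2.1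
      · exact e.2.2.2.2.1
      · exact e.2.2.2.2.2
    · exact absurd e (hn 0)
    · exact absurd e (hn 1)
    · exact absurd e (hn 2)
    · exact absurd e (hn 3)
    · exact absurd e (hn 4)
    · exact absurd e (hn 5)
  choose τ hτ hτ' using hex
  let fl : (Fin 6 → Bool) → Fin 6 → (Fin 6 → Bool) := fun S i => Function.update S i (!(S i))
  have hsg : ∀ S i, sgn S + sgn (fl S i) = 0 := by
    show ∀ S i, sgn S + sgn (Function.update S i (!(S i))) = 0
    unfold sgn
    intro S i
    rw [← Finset.mul_prod_erase Finset.univ _ (Finset.mem_univ i),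
      ← Finset.mul_prod_erase Finset.univ
        (fun j => if Function.update S i (!(S i)) j then (-1 : ℤ) else 1) (Finset.mem_univ i)]
    have : ∏ x ∈ Finset.univ.erase i, (if Function.update S i (!(S i)) x then (-1 : ℤ) else 1)
        = ∏ x ∈ Finset.univ.erase i, (if S x then (-1 : ℤ) else 1) := by
      apply Finset.prod_congr rfl
      intro x hx
      rw [Function.update_of_ne (Finset.ne_of_mem_erase hx)]
    rw [this, Function.update_self]
    cases S i <;> simp
  have hflt : ∀ S i, (τ S i).1 ≠ (a i).1 → τ (fl S i) = τ S := by
    intro S i hi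
    apply hun _ _ (hτ _) (hτ _)
    intro j
    refine M_notSp (hτ' _ _) ?_
    have hj := hτ' S j
    by_cases hji : j = i
    · subst hji
      simp only [M, ff, hi, if_false] at hj ⊢
      exact hj
    · have e : fl S i j = S j := Function.update_of_ne hji _ _
      simp only [M, ff, pt, e] at hj ⊢
      exact hj
  have hptM : ∀ S i, M (ff S i) (pt a b S i) := by
    intro S i
    simp only [M, ff, hpt, if_true]
  have happ : ∀ S, app T (pt a b S) ↔ ∀ i, (τ S i).1 = (a i).1 := by
    intro S
    constructor
    · intro h i
      rw [hun _ _ (hτ S) h (fun i => M_notSp (hτ' S i) (hptM S i))]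
      exact hpt S i
    · intro h
      have : τ S = pt a b S := by
        funext i
        exact M_eq (hτ' S i) (hptM S i) ((h i).trans (hpt S i).symm)
      rw [← this]
      exact hτ S
  have hflfl : ∀ S i, fl (fl S i) i = S := by
    intro S i
    simp [fl]
  have hflne : ∀ S i, fl S i ≠ S := by
    intro S i h
    have := congrFun h i
    simp [fl] at this
  have hall : ∑ S : Fin 6 → Bool, sgn S = 0 :=
    Finset.sum_involution (fun S _ => fl S 0) (fun S _ => hsg S 0) (fun S _ _ => hflne S 0)
      (fun S _ => Finset.mem_univ _) (fun S _ => hflfl S 0)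
  let idx : (Fin 6 → C × K) → Fin 6 :=
    fun t => if h : ∃ i, (t i).1 ≠ (a i).1 then h.choose else 0
  have hidx : ∀ S, ¬ app T (pt a b S) → (τ S (idx (τ S))).1 ≠ (a (idx (τ S))).1 := by
    intro S h
    rw [happ] at h
    push Not at h
    simp only [idx, dif_pos h]
    exact h.choose_spec
  have hnon : ∑ S ∈ Finset.univ.filter (fun S => ¬ app T (pt a b S)), sgn S = 0 := by
    refine Finset.sum_involution (fun S _ => fl S (idx (τ S))) (fun S _ => hsg S _)
      (fun S _ _ => hflne S _) ?_ ?_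
    · intro S hS'
      simp only [Finset.mem_filter, Finset.mem_univ, true_and] at hS' ⊢
      have h1 := hidx S hS'
      intro h2
      rw [happ] at h2
      apply h1
      have := h2 (idx (τ S))
      rwa [hflt S _ h1] at this
    · intro S hS'
      simp only [Finset.mem_filter, Finset.mem_univ, true_and] at hS'
      have h1 := hidx S hS'
      show fl (fl S (idx (τ S))) (idx (τ (fl S (idx (τ S))))) = S
      rw [hflt S _ h1]
      exact hflfl _ _
  rw [← Finset.sum_filter]
  have := Finset.sum_filter_add_sum_filter_not Finset.univ (fun S => app T (pt a b S)) sgn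
  rw [hall, hnon, add_zero] at this
  exact this

theorem Sep6.eq {T : Fam C K} (h : Sep6 T) {a b c d e g a' b' c' d' e' g' : C × K}
    (h1 : T a b c d e g) (h2 : T a' b' c' d' e' g') (n1 : ¬ Sp a a') (n2 : ¬ Sp b b')
    (n3 : ¬ Sp c c') (n4 : ¬ Sp d d') (n5 : ¬ Sp e e') (n6 : ¬ Sp g g') :
    a = a' ∧ b = b' ∧ c = c' ∧ d = d' ∧ e = e' ∧ g = g' := by
  have := h _ _ _ _ _ _ _ _ _ _ _ _ h1 h2
  tauto

theorem nsp_refl (a : C × K) : ¬ Sp a a := fun h => h.2 rfl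

theorem nsp_of {a b : C × K} (h : a.1 ≠ b.1) : ¬ Sp a b := fun h' => h h'.1

theorem classify {T : Fam C K} (hS : Sep6 T)
    {a0 a1 b0 β0 β1 c0 c1 α w4 w5 w6 w4' w5' w6' x0 x1 y0 y1 z0 z1 : C × K}
    (p1 : T a0 b0 c0 w4 w5 w6) (p2 : T a1 β0 c0 w4 w5 w6) (p3 : T α b0 c1 w4 w5 w6)
    (ha : Sp a0 a1) (hc : Sp c0 c1) (hβ : Sp β0 β1) (nα : α.1 ≠ a0.1) (nβ : β0.1 ≠ b0.1)
    (q6 : T a1 β1 c0 x0 y1 w6)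
    (q4 : T a1 β1 c0 w4 y0 z1)
    (hx : Sp x0 x1) (hy : Sp y0 y1) (hz : Sp z0 z1) (nx : x0.1 ≠ w4.1) (ny : y0.1 ≠ w5.1)
    (nz : z0.1 ≠ w6.1) (h4 : Sp w4 w4') (h5 : Sp w5 w5') (h6 : Sp w6 w6')
    (k5 : Kill T a1 β1 c0 x1 w5' z0) (k6 : Kill T a1 β1 c0 x0 y1 w6')
    (k4 : Kill T a1 β1 c0 w4' y0 z1)
    {t1 t2 t3 t4 t5 t6 : C × K} (ht : T t1 t2 t3 t4 t5 t6)
    (e1 : t1 = a1 ∨ t1 = a0) (e2 : t2 = β1 ∨ t2 = β0) (e3 : t3 = c0 ∨ t3 = c1)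
    (e4 : t4 = x1 ∨ t4 = x0) (e5 : t5 = w5 ∨ t5 = w5') (e6 : t6 = z0 ∨ t6 = z1) :
    (t1 = a1 ∧ t2 = β1 ∧ t3 = c0 ∧ t4 = x1 ∧ t5 = w5 ∧ t6 = z0) ∨
    (t1 = a0 ∧ t2 = β0 ∧ t3 = c1 ∧ t5 = w5') := by
  have c1' : t1.1 = a1.1 := by rcases e1 with rfl | rfl; exacts [rfl, ha.1]
  have c2' : t2.1 = β1.1 := by rcases e2 with rfl | rfl; exacts [rfl, hβ.1]
  have c3' : t3.1 = c0.1 := by rcases e3 with rfl | rfl; exacts [rfl, hc.1.symm]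
  have c4' : t4.1 = x0.1 := by rcases e4 with rfl | rfl; exacts [hx.1.symm, rfl]
  have c5' : t5.1 = w5.1 := by rcases e5 with rfl | rfl; exacts [rfl, h5.1.symm]
  have c6' : t6.1 = z0.1 := by rcases e6 with rfl | rfl; exacts [rfl, hz.1.symm]
  have n2b : t2.1 ≠ b0.1 := by rw [c2', ← hβ.1]; exact nβ
  have n4w : t4.1 ≠ w4.1 := by rw [c4']; exact nx
  have n6w : t6.1 ≠ w6.1 := by rw [c6']; exact nz
  rcases e5 with rfl | rfl
  · left
    have d3 : t3 = c0 := by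
      rcases e3 with h | rfl
      · exact h
      exfalso
      have := hS.eq ht p3 (nsp_of (by rw [c1', ← ha.1]; exact nα.symm)) (nsp_of n2b)
        (nsp_refl _) (nsp_of n4w) (nsp_refl _) (nsp_of n6w)
      exact n2b (congrArg Prod.fst this.2.1)
    subst d3
    have d1 : t1 = a1 := by
      rcases e1 with h | rfl
      · exact h
      exfalso
      have := hS.eq ht p1 (nsp_refl _) (nsp_of n2b)
        (nsp_refl _) (nsp_of n4w) (nsp_refl _) (nsp_of n6w)
      exact n2b (congrArg Prod.fst this.2.1)
    subst d1
    have d2 : t2 = β1 := by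
      rcases e2 with h | rfl
      · exact h
      exfalso
      have := hS.eq ht p2 (nsp_refl _) (nsp_refl _)
        (nsp_refl _) (nsp_of n4w) (nsp_refl _) (nsp_of n6w)
      exact n4w (congrArg Prod.fst this.2.2.2.1)
    subst d2
    refine ⟨rfl, rfl, rfl, ?_, rfl, ?_⟩
    · rcases e4 with h | rfl
      · exact h
      exfalso
      have := hS.eq ht q6 (nsp_refl _) (nsp_refl _)
        (nsp_refl _) (nsp_refl _) (nsp_of (by rw [← hy.1]; exact ny.symm)) (nsp_of n6w)
      exact n6w (congrArg Prod.fst this.2.2.2.2.2)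
    · rcases e6 with h | rfl
      · exact h
      exfalso
      have := hS.eq ht q4 (nsp_refl _) (nsp_refl _)
        (nsp_refl _) (nsp_of n4w) (nsp_of ny.symm) (nsp_refl _)
      exact n4w (congrArg Prod.fst this.2.2.2.1)
  · right
    have key : t1 ≠ a1 ∧ t2 ≠ β1 ∧ t3 ≠ c0 := by
      rcases e4 with rfl | rfl
      · rcases e6 with rfl | rfl
        · exact k5 _ _ _ _ _ _ ht c1' c2' c3' (nsp_refl _) (nsp_refl _) (nsp_refl _)
        · exact k4 _ _ _ _ _ _ ht c1' c2' c3' (nsp_of (by rw [← h4.1]; exact n4w))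
            (nsp_of (by rw [c5']; exact ny.symm)) (nsp_refl _)
      · exact k6 _ _ _ _ _ _ ht c1' c2' c3' (nsp_refl _)
          (nsp_of (by rw [c5', ← hy.1]; exact ny.symm)) (nsp_of (by rw [← h6.1]; exact n6w))
    exact ⟨e1.resolve_left key.1, e2.resolve_left key.2.1, e3.resolve_left key.2.2, rfl⟩

theorem Sp.ne {a b : C × K} (h : Sp a b) : a ≠ b := fun e => h.2 (congrArg Prod.snd e)

open Classical in
theorem lemE {T : Fam C K} (hE : Ex6 T) (hS : Sep6 T)
    {a0 a1 b0 β0 β1 c0 c1 α w4 w5 w6 w4' w5' w6' x0 x1 y0 y1 z0 z1 : C × K}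
    (p1 : T a0 b0 c0 w4 w5 w6) (p2 : T a1 β0 c0 w4 w5 w6) (p3 : T α b0 c1 w4 w5 w6)
    (ha : Sp a0 a1) (hc : Sp c0 c1) (hβ : Sp β0 β1) (nα : α.1 ≠ a0.1) (nβ : β0.1 ≠ b0.1)
    (q5 : T a1 β1 c0 x1 w5 z0) (q6 : T a1 β1 c0 x0 y1 w6)
    (q4 : T a1 β1 c0 w4 y0 z1)
    (hx : Sp x0 x1) (hy : Sp y0 y1) (hz : Sp z0 z1) (nx : x0.1 ≠ w4.1) (ny : y0.1 ≠ w5.1)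
    (nz : z0.1 ≠ w6.1) (h4 : Sp w4 w4') (h5 : Sp w5 w5') (h6 : Sp w6 w6')
    (k5 : Kill T a1 β1 c0 x1 w5' z0) (k6 : Kill T a1 β1 c0 x0 y1 w6')
    (k4 : Kill T a1 β1 c0 w4' y0 z1) :
    ∃ s5 : C × K, s5.1 = w5.1 ∧ (T a0 β0 c1 x0 s5 z0 ∨ T a0 β0 c1 x1 s5 z1) := by
  refine ⟨w5', h5.1.symm, ?_⟩
  by_contra hcon
  push Not at hcon
  obtain ⟨hc1, hc2⟩ := hcon
  have hpar := parity hE hS ![a1, β1, c0, x1, w5, z0] ![a0, β0, c1, x0, w5', z1] (by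
    intro i
    fin_cases i
    · exact ha.symm
    · exact hβ.symm
    · exact hc
    · exact hx.symm
    · exact h5
    · exact hz)
  have hb : app T (pt ![a1, β1, c0, x1, w5, z0] ![a0, β0, c1, x0, w5', z1] (fun _ => false)) := q5
  refine absurd hpar (ne_of_gt (Finset.sum_pos' ?_ ⟨fun _ => false, Finset.mem_univ _, ?_⟩))
  · intro S _
    split_ifs with h
    swap
    · exact le_rfl
    have h' : T (if S 0 then a0 else a1) (if S 1 then β0 else β1) (if S 2 then c1 else c0)
      (if S 3 then x0 else x1) (if S 4 then w5' else w5) (if S 5 then z1 else z0) := h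
    have hs : sgn S = (if S 0 then -1 else 1) * (if S 1 then -1 else 1) * (if S 2 then -1 else 1)
      * (if S 3 then -1 else 1) * (if S 4 then -1 else 1) * (if S 5 then -1 else 1) := by
      unfold sgn
      rw [Fin.prod_univ_six]
    rw [hs]
    have aux : ∀ (s : Bool) (p q : C × K), (if s then p else q) = q ∨ (if s then p else q) = p := by
      intro s p q
      cases s <;> simp
    have R := classify hS p1 p2 p3 ha hc hβ nα nβ q6 q4 hx hy hz nx ny nz h4 h5 h6 k5 k6 k4 h'
      (aux _ _ _) (aux _ _ _) (aux _ _ _) (aux _ _ _) (aux _ _ _) (aux _ _ _)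
    have auxf : ∀ (s : Bool) (p q : C × K), p ≠ q → (if s then p else q) = q → s = false := by
      intro s p q
      cases s <;> simp
    have auxt : ∀ (s : Bool) (p q : C × K), p ≠ q → (if s then p else q) = p → s = true := by
      intro s p q
      cases s
      · simp
        intro h h'
        exact h h'.symm
      · simp
    rcases R with ⟨r0, r1, r2, r3, r4, r5⟩ | ⟨r0, r1, r2, r4⟩
    · rw [auxf _ _ _ ha.ne r0, auxf _ _ _ hβ.ne r1, auxf _ _ _ hc.symm.ne r2,
        auxf _ _ _ hx.ne r3, auxf _ _ _ h5.symm.ne r4, auxf _ _ _ hz.symm.ne r5]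
      simp
    · have s0 := auxt _ _ _ ha.ne r0
      have s1 := auxt _ _ _ hβ.ne r1
      have s2 := auxt _ _ _ hc.symm.ne r2
      have s4 := auxt _ _ _ h5.symm.ne r4
      rw [s0, s1, s2, s4] at h'
      rw [s0, s1, s2, s4]
      cases s3 : S 3 <;> cases s5 : S 5 <;> rw [s3, s5] at h'
      · simp
      · exact absurd h' hc2
      · exact absurd h' hc1
      · simp
  · rw [if_pos hb]
    simp [sgn]

theorem Kill.rot {T : Fam C K} {u1 u2 u3 v4 v5 v6 : C × K} (h : Kill T u1 u2 u3 v4 v5 v6) :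
    Kill (rotT T) u1 u2 u3 v5 v6 v4 := by
  intro t1 t2 t3 s4 s5 s6 ht e1 e2 e3 n4 n5 n6
  exact h t1 t2 t3 s6 s4 s5 ht e1 e2 e3 n6 n4 n5

theorem Kill.unrot {T : Fam C K} {u1 u2 u3 v4 v5 v6 : C × K}
    (h : Kill (rotT T) u1 u2 u3 v5 v6 v4) : Kill T u1 u2 u3 v4 v5 v6 := by
  intro t1 t2 t3 s4 s5 s6 ht e1 e2 e3 n4 n5 n6
  exact h t1 t2 t3 s5 s6 s4 ht e1 e2 e3 n5 n6 n4

theorem main_abs {T : Fam C K} (hE : Ex6 T) (hS : Sep6 T) (hN : NC6 T)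
    {a0 a1 b0 β c0 c1 α w4 w5 w6 : C × K}
    (p1 : T a0 b0 c0 w4 w5 w6) (p2 : T a1 β c0 w4 w5 w6) (p3 : T α b0 c1 w4 w5 w6)
    (ha : Sp a0 a1) (hc : Sp c0 c1) (nα : α.1 ≠ a0.1) (nβ : β.1 ≠ b0.1) : False := by
  obtain ⟨k, hk, x0, x1, y0, y1, z0, z1, hx, hy, hz, nx, ny, nz, q0, q5, q6, q4⟩ :=
    line6 hE hS hN p1 p2 p3 ha hc nα nβ
  have hβ : Sp β (β.1, k) := ⟨rfl, hk.symm⟩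
  obtain ⟨w5', h5, k5⟩ := kill_line hE hS hN q0 q5 q4 hx hz nx.symm ny.symm
  obtain ⟨w6', h6, k6⟩ := kill_line (T := rotT T) hE.rot hS.rot hN.rot
    (x0 := y0) (x1 := y1) (y0 := z0) (z0 := x0) (z1 := x1) (w4 := w5) (w5 := w6)
    q0 q6 q5 hy hx ny.symm nz.symm
  obtain ⟨w4', h4, k4⟩ := kill_line (T := rotT (rotT T)) hE.rot.rot hS.rot.rot hN.rot.rot
    (x0 := z0) (x1 := z1) (y0 := x0) (z0 := y0) (z1 := y1) (w4 := w6) (w5 := w4)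
    q0 q4 q6 hz hy nz.symm nx.symm
  have k6 := k6.unrot
  have k4 := k4.unrot.unrot
  obtain ⟨s5, r5, E5⟩ := lemE hE hS p1 p2 p3 ha hc hβ nα nβ q5 q6 q4 hx hy hz nx ny nz h4 h5 h6
    k5 k6 k4
  obtain ⟨s6, r6, E6⟩ := lemE (T := rotT T) hE.rot hS.rot p1 p2 p3 ha hc hβ nα nβ q6 q4 q5
    hy hz hx ny nz nx h5 h6 h4 k6.rot k4.rot k5.rot
  obtain ⟨s4, r4, E4⟩ := lemE (T := rotT (rotT T)) hE.rot.rot hS.rot.rot p1 p2 p3 ha hc hβ nα nβ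
    q4 q5 q6 hz hx hy nz nx ny h6 h4 h5 k4.rot.rot k5.rot.rot k6.rot.rot
  -- the three conclusions cannot hold together
  have nx1 : x1.1 ≠ w4.1 := by rw [← hx.1]; exact nx
  have ny1 : y1.1 ≠ w5.1 := by rw [← hy.1]; exact ny
  have nz1 : z1.1 ≠ w6.1 := by rw [← hz.1]; exact nz
  rw [← r4] at nx nx1
  rw [← r5] at ny ny1
  rw [← r6] at nz nz1
  have c56 : ∀ x y z, y.1 ≠ s5.1 → z.1 ≠ s6.1 → T a0 β c1 x s5 z → T a0 β c1 x y s6 → False := by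
    intro x y z h1 h2 h h'
    exact h1 (congrArg Prod.fst (hS.eq h h' (nsp_refl _) (nsp_refl _) (nsp_refl _) (nsp_refl _)
      (nsp_of h1.symm) (nsp_of h2)).2.2.2.2.1).symm
  have c54 : ∀ x y z, y.1 ≠ s5.1 → x.1 ≠ s4.1 → T a0 β c1 x s5 z → T a0 β c1 s4 y z → False := by
    intro x y z h1 h2 h h'
    exact h1 (congrArg Prod.fst (hS.eq h h' (nsp_refl _) (nsp_refl _) (nsp_refl _) (nsp_of h2)
      (nsp_of h1.symm) (nsp_refl _)).2.2.2.2.1).symm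
  have c64 : ∀ x y z, z.1 ≠ s6.1 → x.1 ≠ s4.1 → T a0 β c1 x y s6 → T a0 β c1 s4 y z → False := by
    intro x y z h1 h2 h h'
    exact h2 (congrArg Prod.fst (hS.eq h h' (nsp_refl _) (nsp_refl _) (nsp_refl _) (nsp_of h2)
      (nsp_refl _) (nsp_of h1.symm)).2.2.2.1)
  have E6' : T a0 β c1 x0 y0 s6 ∨ T a0 β c1 x1 y1 s6 := E6
  have E4' : T a0 β c1 s4 y0 z0 ∨ T a0 β c1 s4 y1 z1 := E4
  rcases E5 with A5 | A5 <;> rcases E6' with A6 | A6 <;> rcases E4' with A4 | A4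
  · exact c56 _ _ _ ny nz A5 A6
  · exact c56 _ _ _ ny nz A5 A6
  · exact c54 _ _ _ ny nx A5 A4
  · exact c64 _ _ _ nz1 nx1 A6 A4
  · exact c64 _ _ _ nz nx A6 A4
  · exact c54 _ _ _ ny1 nx1 A5 A4
  · exact c56 _ _ _ ny1 nz1 A5 A6
  · exact c56 _ _ _ ny1 nz1 A5 A6

theorem sel_unique {T : Set (Fin 6 → ℝ)} (hT : IsCubeTiling T) (J : Finset (Fin 6)) :
    ∀ S : Fin 6 → Set ℝ, (∀ i ∈ J, ∀ x : ℝ, ∃! m : ℤ, x + m ∈ S i) →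
      (∀ i, i ∉ J → ∃ p : ℝ, S i = Set.Ioc (p - 1) p) → ∃! t, t ∈ T ∧ ∀ i, t i ∈ S i := by
  induction J using Finset.induction_on with
  | empty =>
    intro S _ hS
    have hS' : ∀ i, ∃ p : ℝ, S i = Set.Ioc (p - 1) p := fun i => hS i (Finset.notMem_empty i)
    choose p hp using hS'
    have hmem : ∀ t : Fin 6 → ℝ, (∀ i, t i ∈ S i) ↔ p ∈ Cube t := by
      intro t
      constructor
      · intro h i
        have := h i
        rw [hp] at this
        exact ⟨this.2, by linarith [this.1]⟩
      · intro h i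
        rw [hp]
        exact ⟨by linarith [(h i).2], (h i).1⟩
    have hc : p ∈ ⋃ t ∈ T, Cube t := by
      rw [hT.2]
      trivial
    simp only [Set.mem_iUnion] at hc
    obtain ⟨t, ht, hpt⟩ := hc
    refine ⟨t, ⟨ht, (hmem t).2 hpt⟩, ?_⟩
    rintro s ⟨hs, hs'⟩
    by_contra hne
    exact Set.disjoint_left.1 (hT.1 s hs t ht hne) ((hmem s).1 hs') hpt
  | insert j J hj ih =>
    intro S hSel hWin
    let U : Set (Fin 6 → ℝ) := {t | t ∈ T ∧ ∀ i, i ≠ j → t i ∈ S i}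
    have hU : ∀ p : ℝ, ∃! t, t ∈ U ∧ t j ∈ Set.Ioc (p - 1) p := by
      intro p
      have key : ∀ t : Fin 6 → ℝ, (t ∈ T ∧ ∀ i, t i ∈ Function.update S j (Set.Ioc (p - 1) p) i) ↔
          (t ∈ U ∧ t j ∈ Set.Ioc (p - 1) p) := by
        intro t
        constructor
        · rintro ⟨h1, h2⟩
          refine ⟨⟨h1, fun i hi => ?_⟩, ?_⟩
          · have := h2 i
            rwa [Function.update_of_ne hi] at this
          · have := h2 j
            rwa [Function.update_self] at this
        · rintro ⟨⟨h1, h2⟩, h3⟩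
          refine ⟨h1, fun i => ?_⟩
          by_cases hi : i = j
          · subst hi
            rwa [Function.update_self]
          · rw [Function.update_of_ne hi]
            exact h2 i hi
      have := ih (Function.update S j (Set.Ioc (p - 1) p)) ?_ ?_
      · simpa only [key] using this
      · intro i hi
        have hij : i ≠ j := by
          rintro rfl
          exact hj hi
        rw [Function.update_of_ne hij]
        exact hSel i (Finset.mem_insert_of_mem hi)
      · intro i hi
        by_cases hij : i = j
        · subst hij
          exact ⟨p, Function.update_self _ _ _⟩
        · rw [Function.update_of_ne hij]
          apply hWin
          simp [hij, hi]
    have inj : ∀ t ∈ U, ∀ t' ∈ U, t j ≤ t' j → t' j < t j + 1 → t = t' := by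
      intro t ht t' ht' h1 h2
      exact (hU (t' j)).unique ⟨ht, by linarith, h1⟩ ⟨ht', by linarith, le_rfl⟩
    have up : ∀ t ∈ U, ∃ t' ∈ U, t' j = t j + 1 := by
      intro t ht
      obtain ⟨t', ⟨ht', h1, h2⟩, -⟩ := hU (t j + 1)
      refine ⟨t', ht', le_antisymm h2 ?_⟩
      by_contra h3
      push Not at h3
      have := inj t ht t' ht' (by linarith) h3
      subst this
      linarith
    have down : ∀ t ∈ U, ∃ t' ∈ U, t' j = t j - 1 := by
      intro t ht
      obtain ⟨t', ⟨ht', h1, h2⟩, -⟩ := hU (t j - 1)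
      obtain ⟨t'', ht'', h3⟩ := up t' ht'
      have := inj t'' ht'' t ht (by linarith) (by linarith)
      subst this
      exact ⟨t', ht', by linarith⟩
    have ints : ∀ t ∈ U, ∀ m : ℤ, ∃ t' ∈ U, t' j = t j + m := by
      intro t ht m
      induction m using Int.induction_on with
      | zero => exact ⟨t, ht, by simp⟩
      | succ n h =>
        obtain ⟨t', h1, h2⟩ := h
        obtain ⟨t'', h3, h4⟩ := up t' h1
        exact ⟨t'', h3, by rw [h4, h2]; push_cast; ring⟩
      | pred n h =>
        obtain ⟨t', h1, h2⟩ := h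
        obtain ⟨t'', h3, h4⟩ := down t' h1
        exact ⟨t'', h3, by rw [h4, h2]; push_cast; ring⟩
    have coset : ∀ t ∈ U, ∀ t' ∈ U, ∃ m : ℤ, t' j = t j + m := by
      intro t ht t' ht'
      obtain ⟨t'', h1, h2⟩ := ints t ht ⌊t' j - t j⌋
      have h3 := Int.floor_le (t' j - t j)
      have h4 := Int.lt_floor_add_one (t' j - t j)
      have := inj t'' h1 t' ht' (by linarith) (by linarith)
      subst this
      exact ⟨_, h2⟩
    obtain ⟨t0, ⟨ht0, -⟩, -⟩ := hU 0
    have hSj := hSel j (Finset.mem_insert_self j J)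
    obtain ⟨m, hm, -⟩ := hSj (t0 j)
    obtain ⟨t, ht, htj⟩ := ints t0 ht0 m
    have hts : t j ∈ S j := by
      rw [htj]
      exact hm
    refine ⟨t, ⟨ht.1, fun i => ?_⟩, ?_⟩
    · by_cases hi : i = j
      · subst hi
        exact hts
      · exact ht.2 i hi
    · rintro s ⟨hs1, hs2⟩
      have hs : s ∈ U := ⟨hs1, fun i _ => hs2 i⟩
      obtain ⟨n, hn⟩ := coset t ht s hs
      have h0 : n = 0 := by
        refine (hSj (t j)).unique ?_ ?_
        · have := hs2 j
          rw [hn] at this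
          exact this
        · simpa using hts
      rw [h0] at hn
      refine inj s hs t ht ?_ ?_
      · simp at hn
        exact hn.le
      · simp at hn
        linarith

/-- fractional part and floor -/
noncomputable def enc (x : ℝ) : ℝ × ℤ := (Int.fract x, ⌊x⌋)

theorem enc_inj {x y : ℝ} (h : enc x = enc y) : x = y := by
  have h1 : Int.fract x = Int.fract y := congrArg Prod.fst h
  have h2 : ⌊x⌋ = ⌊y⌋ := congrArg Prod.snd h
  rw [← Int.floor_add_fract x, ← Int.floor_add_fract y, h1, h2]

theorem sel_enc (f : ℝ → ℤ) (x : ℝ) : ∃! m : ℤ, x + m ∈ {y : ℝ | M f (enc y)} := by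
  refine ⟨f (Int.fract x) - ⌊x⌋, ?_, ?_⟩
  · show f (Int.fract (x + ((f (Int.fract x) - ⌊x⌋ : ℤ) : ℝ))) =
      ⌊x + ((f (Int.fract x) - ⌊x⌋ : ℤ) : ℝ)⌋
    rw [Int.fract_add_intCast, Int.floor_add_intCast]
    ring
  · intro m hm
    have hm' : f (Int.fract (x + (m : ℝ))) = ⌊x + (m : ℝ)⌋ := hm
    rw [Int.fract_add_intCast, Int.floor_add_intCast] at hm'
    linarith

theorem enc_unique {T : Set (Fin 6 → ℝ)} (hT : IsCubeTiling T) (f : Fin 6 → ℝ → ℤ) :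
    ∃! t, t ∈ T ∧ ∀ i, M (f i) (enc (t i)) :=
  sel_unique hT Finset.univ (fun i => {y : ℝ | M (f i) (enc y)}) (fun i _ x => sel_enc (f i) x)
    (fun i hi => absurd (Finset.mem_univ i) hi)

def T6 (T : Set (Fin 6 → ℝ)) : Fam ℝ ℤ := fun a b c d e g =>
  ∃ t ∈ T, enc (t 0) = a ∧ enc (t 1) = b ∧ enc (t 2) = c ∧ enc (t 3) = d ∧ enc (t 4) = e ∧
    enc (t 5) = g

theorem T6.mk {T : Set (Fin 6 → ℝ)} {t : Fin 6 → ℝ} (h : t ∈ T) :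
    T6 T (enc (t 0)) (enc (t 1)) (enc (t 2)) (enc (t 3)) (enc (t 4)) (enc (t 5)) :=
  ⟨t, h, rfl, rfl, rfl, rfl, rfl, rfl⟩

theorem T6_ex {T : Set (Fin 6 → ℝ)} (hT : IsCubeTiling T) : Ex6 (T6 T) := by
  intro f1 f2 f3 f4 f5 f6
  obtain ⟨t, ⟨ht, h⟩, -⟩ := enc_unique hT ![f1, f2, f3, f4, f5, f6]
  exact ⟨_, _, _, _, _, _, T6.mk ht, h 0, h 1, h 2, h 3, h 4, h 5⟩

theorem T6_sep {T : Set (Fin 6 → ℝ)} (hT : IsCubeTiling T) : Sep6 (T6 T) := by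
  rintro _ _ _ _ _ _ _ _ _ _ _ _ ⟨s, hs, rfl, rfl, rfl, rfl, rfl, rfl⟩
    ⟨t, ht, rfl, rfl, rfl, rfl, rfl, rfl⟩
  by_cases h : ∀ i, ¬ Sp (enc (s i)) (enc (t i))
  · left
    have h' : ∀ i, ∃ f : ℝ → ℤ, M f (enc (s i)) ∧ M f (enc (t i)) :=
      fun i => exists_M2 _ _ (h i)
    choose f hf using h'
    have := (enc_unique hT f).unique ⟨hs, fun i => (hf i).1⟩ ⟨ht, fun i => (hf i).2⟩
    subst this
    exact ⟨rfl, rfl, rfl, rfl, rfl, rfl⟩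
  · right
    push Not at h
    obtain ⟨i, hi⟩ := h
    fin_cases i
    · exact Or.inl hi
    · exact Or.inr (Or.inl hi)
    · exact Or.inr (Or.inr (Or.inl hi))
    · exact Or.inr (Or.inr (Or.inr (Or.inl hi)))
    · exact Or.inr (Or.inr (Or.inr (Or.inr (Or.inl hi))))
    · exact Or.inr (Or.inr (Or.inr (Or.inr (Or.inr hi))))

theorem column_of {T : Set (Fin 6 → ℝ)} (i : Fin 6) (q : ℝ) (v : Fin 6 → ℝ × ℤ)
    (h : ∀ k : ℤ, ∃ t ∈ T, enc (t i) = (q, k) ∧ ∀ j, j ≠ i → enc (t j) = v j) :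
    ContainsColumn T := by
  obtain ⟨s, -, hsi, hsj⟩ := h 0
  refine ⟨s, i, fun k => ?_⟩
  obtain ⟨t, ht, hti, htj⟩ := h k
  have e : s + (k : ℝ) • (Pi.single i 1 : Fin 6 → ℝ) = t := by
    funext j
    by_cases hj : j = i
    · subst hj
      apply enc_inj
      rw [hti]
      have h1 : Int.fract (s j) = q := congrArg Prod.fst hsi
      have h2 : ⌊s j⌋ = 0 := congrArg Prod.snd hsi
      simp [enc, h1, h2]
    · have := enc_inj ((hsj j hj).trans (htj j hj).symm)
      simp [hj, this]
  rw [e]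
  exact ht

theorem T6_nc {T : Set (Fin 6 → ℝ)} (hT : ¬ ContainsColumn T) : NC6 (T6 T) := by
  refine ⟨?_, ?_, ?_, ?_, ?_, ?_⟩
  · intro q b c d e g
    by_contra! h
    refine hT (column_of 0 q ![b, b, c, d, e, g] (fun k => ?_))
    obtain ⟨t, ht, h0, h1, h2, h3, h4, h5⟩ := h k
    refine ⟨t, ht, h0, ?_⟩
    intro j hj
    fin_cases j
    exacts [absurd rfl hj, h1, h2, h3, h4, h5]
  · intro b q c d e g
    by_contra! h
    refine hT (column_of 1 q ![b, b, c, d, e, g] (fun k => ?_))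
    obtain ⟨t, ht, h0, h1, h2, h3, h4, h5⟩ := h k
    refine ⟨t, ht, h1, ?_⟩
    intro j hj
    fin_cases j
    exacts [h0, absurd rfl hj, h2, h3, h4, h5]
  · intro b c q d e g
    by_contra! h
    refine hT (column_of 2 q ![b, c, c, d, e, g] (fun k => ?_))
    obtain ⟨t, ht, h0, h1, h2, h3, h4, h5⟩ := h k
    refine ⟨t, ht, h2, ?_⟩
    intro j hj
    fin_cases j
    exacts [h0, h1, absurd rfl hj, h3, h4, h5]
  · intro b c d q e g
    by_contra! h
    refine hT (column_of 3 q ![b, c, d, d, e, g] (fun k => ?_))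
    obtain ⟨t, ht, h0, h1, h2, h3, h4, h5⟩ := h k
    refine ⟨t, ht, h3, ?_⟩
    intro j hj
    fin_cases j
    exacts [h0, h1, h2, absurd rfl hj, h4, h5]
  · intro b c d e q g
    by_contra! h
    refine hT (column_of 4 q ![b, c, d, e, e, g] (fun k => ?_))
    obtain ⟨t, ht, h0, h1, h2, h3, h4, h5⟩ := h k
    refine ⟨t, ht, h4, ?_⟩
    intro j hj
    fin_cases j
    exacts [h0, h1, h2, h3, absurd rfl hj, h5]
  · intro b c d e g q
    by_contra! h
    refine hT (column_of 5 q ![b, c, d, e, g, g] (fun k => ?_))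
    obtain ⟨t, ht, h0, h1, h2, h3, h4, h5⟩ := h k
    refine ⟨t, ht, h5, ?_⟩
    intro j hj
    fin_cases j
    exacts [h0, h1, h2, h3, h4, absurd rfl hj]

theorem enc_sp {x y : ℝ} (h : ∃ m : ℤ, m ≠ 0 ∧ y - x = m) : Sp (enc x) (enc y) := by
  obtain ⟨m, hm, h⟩ := h
  have e : y = x + m := by linarith
  subst e
  refine ⟨?_, ?_⟩
  · simp [enc]
  · simpa [enc] using hm

theorem enc_ne {x y : ℝ} (h : ¬ ∃ m : ℤ, y - x = m) : (enc y).1 ≠ (enc x).1 := by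
  intro e
  have e' : Int.fract y = Int.fract x := e
  exact h (Int.fract_eq_fract.1 e')

end FourVec

/-- Lemma 6 of the paper: a cube tiling of `ℝ⁶` containing four vectors with the
indicated pattern contains a column. -/
theorem lemma_four_vectors_dim6 (T : Set (Fin 6 → ℝ)) (hT : IsCubeTiling T)
    (w1 w2 w3 w4 : Fin 6 → ℝ)
    (hw1 : w1 ∈ T) (hw2 : w2 ∈ T) (hw3 : w3 ∈ T) (hw4 : w4 ∈ T)
    (hlast : ∀ i : Fin 6, 3 ≤ (i : ℕ) → w2 i = w1 i ∧ w3 i = w1 i ∧ w4 i = w1 i)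
    (h1a : w3 0 = w1 0) (h1b : ∃ m : ℤ, m ≠ 0 ∧ w2 0 - w1 0 = m)
    (h1c : ¬ ∃ m : ℤ, w4 0 - w1 0 = m)
    (h2a : w4 1 = w1 1) (h2b : ∃ m : ℤ, m ≠ 0 ∧ w3 1 - w1 1 = m)
    (h2c : ¬ ∃ m : ℤ, w2 1 - w1 1 = m)
    (h3a : w2 2 = w1 2) (h3b : ∃ m : ℤ, m ≠ 0 ∧ w4 2 - w1 2 = m)
    (h3c : ¬ ∃ m : ℤ, w3 2 - w1 2 = m) :
    ∃ s : Fin 6 → ℝ, ∃ i : Fin 6, ∀ k : ℤ, (s + (k : ℝ) • (Pi.single i 1 : Fin 6 → ℝ)) ∈ T := by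
  by_contra hcol
  have hN : FourVec.NC6 (FourVec.T6 T) := FourVec.T6_nc hcol
  have p1 := FourVec.T6.mk hw1
  have p2 := FourVec.T6.mk hw2
  have p3 := FourVec.T6.mk hw4
  rw [h3a, (hlast 3 (by decide)).1, (hlast 4 (by decide)).1, (hlast 5 (by decide)).1] at p2
  rw [h2a, (hlast 3 (by decide)).2.2, (hlast 4 (by decide)).2.2,
    (hlast 5 (by decide)).2.2] at p3
  exact FourVec.main_abs (FourVec.T6_ex hT) (FourVec.T6_sep hT) hN p1 p2 p3
    (FourVec.enc_sp h1b) (FourVec.enc_sp h3b) (FourVec.enc_ne h1c) (FourVec.enc_ne h2c)
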